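/- Let V be a Hilbert space and V_1, ..., V_m closed subspaces of V such that V = V_1 + ... + V_m. Then there exists a constant L ∈ [0,1) such that for every u ∈ V, every initial guess u^0 ∈ V, and every multiplicative Schwarz iteration (u^{n,i}) for u (i.e., u^{n,0} = u^{n-1,m} for n ≥ 2, u^{1,0} = u^0, u^{n,i} - u^{n,i-1} ∈ V_i, and ⟨u - u^{n,i}, v⟩ = 0 for all v ∈ V_i and all n ≥ 1, 1 ≤ i ≤ m), one has ‖u - u^{n,m}‖ ≤ L^n ‖u - u^0‖ for all n ≥ 1. -/

import Mathlib

open Submodule RealInnerProductSpace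

/-- Closed subspaces that sum to the whole space admit uniformly bounded decompositions. -/
theorem exists_bounded_decomposition {V ι : Type*} [NormedAddCommGroup V] [NormedSpace ℝ V]
    [CompleteSpace V] [Fintype ι] (W : ι → Submodule ℝ V)
    (hclosed : ∀ i, IsClosed (W i : Set V))
    (hsum : ∀ v : V, ∃ f : ι → V, (∀ i, f i ∈ W i) ∧ v = ∑ i, f i) :
    ∃ C : ℝ, 0 < C ∧ ∀ v : V, ∃ f : ι → V,
      (∀ i, f i ∈ W i) ∧ v = ∑ i, f i ∧ ∀ i, ‖f i‖ ≤ C * ‖v‖ := by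
  have (i : ι) : CompleteSpace (W i) := (hclosed i).completeSpace_coe
  let T : (∀ i, W i) →L[ℝ] V := ∑ i, (W i).subtypeL ∘L ContinuousLinearMap.proj i
  have hT (x : ∀ i, W i) : T x = ∑ i, (x i : V) := by simp [T]
  have hsurj : Function.Surjective T := fun v => by
    obtain ⟨f, hf, hv⟩ := hsum v
    exact ⟨fun i => ⟨f i, hf i⟩, by rw [hT, hv]⟩
  obtain ⟨C, hC, h⟩ := T.exists_preimage_norm_le hsurj
  refine ⟨C, hC, fun v => ?_⟩
  obtain ⟨x, hx, hxn⟩ := h v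
  exact ⟨fun i => x i, fun i => (x i).2, by rw [← hx, hT],
    fun i => (norm_le_pi_norm x i).trans hxn⟩

/-- The error `e` of one sweep of successive subspace corrections satisfies the energy identity
`∑ ‖e i - e (i + 1)‖ ^ 2 = ‖e 0‖ ^ 2 - ‖e m‖ ^ 2`. -/
theorem sum_norm_sq_correction_eq {V : Type*} [NormedAddCommGroup V] [InnerProductSpace ℝ V]
    {m : ℕ} (W : Fin m → Submodule ℝ V) (e : ℕ → V)
    (hmem : ∀ i : Fin m, e i - e (i + 1) ∈ W i)
    (horth : ∀ i : Fin m, ∀ v ∈ W i, ⟪e (i + 1), v⟫ = 0) :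
    ∑ i ∈ Finset.range m, ‖e i - e (i + 1)‖ ^ 2 = ‖e 0‖ ^ 2 - ‖e m‖ ^ 2 := by
  rw [← Finset.sum_range_sub' (fun i => ‖e i‖ ^ 2)]
  refine Finset.sum_congr rfl fun i hi => ?_
  let j : Fin m := ⟨i, Finset.mem_range.mp hi⟩
  have h := horth j _ (hmem j)
  have hadd := norm_add_sq_real (e (i + 1)) (e i - e (i + 1))
  rw [add_sub_cancel, h] at hadd
  linarith

/-- One sweep of successive subspace corrections is controlled by the drop in energy. -/
theorem norm_sq_sweep_le {V : Type*} [NormedAddCommGroup V] [InnerProductSpace ℝ V]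
    {m : ℕ} (W : Fin m → Submodule ℝ V) {C : ℝ} (hC : 0 ≤ C)
    (hdecomp : ∀ v : V, ∃ f : Fin m → V,
      (∀ i, f i ∈ W i) ∧ v = ∑ i, f i ∧ ∀ i, ‖f i‖ ≤ C * ‖v‖)
    (e : ℕ → V) (hmem : ∀ i : Fin m, e i - e (i + 1) ∈ W i)
    (horth : ∀ i : Fin m, ∀ v ∈ W i, ⟪e (i + 1), v⟫ = 0) :
    ‖e m‖ ^ 2 ≤ (m * C) ^ 2 * m * (‖e 0‖ ^ 2 - ‖e m‖ ^ 2) := by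
  rw [← sum_norm_sq_correction_eq W e hmem horth]
  set S := ∑ i ∈ Finset.range m, ‖e i - e (i + 1)‖ with hS
  have hS0 : 0 ≤ S := by positivity
  have hdist (i : Fin m) : ‖e m - e (i + 1)‖ ≤ S := by
    rw [norm_sub_rev, ← dist_eq_norm]
    refine (dist_le_Ico_sum_dist e (Nat.succ_le_of_lt i.2)).trans ?_
    simp only [dist_eq_norm, hS]
    refine Finset.sum_le_sum_of_subset_of_nonneg (fun j hj => ?_) fun _ _ _ => norm_nonneg _
    exact Finset.mem_range.mpr (Finset.mem_Ico.mp hj).2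
  obtain ⟨f, hf, hsum, hbound⟩ := hdecomp (e m)
  have hsq : ‖e m‖ ^ 2 ≤ m * (S * (C * ‖e m‖)) := by
    calc ‖e m‖ ^ 2 = ∑ i, ⟪e m, f i⟫ := by
          rw [← inner_sum, ← hsum, real_inner_self_eq_norm_sq]
      _ = ∑ i : Fin m, ⟪e m - e (i + 1), f i⟫ := by
          refine Finset.sum_congr rfl fun i _ => ?_
          rw [inner_sub_left, horth i _ (hf i), sub_zero]
      _ ≤ ∑ _i : Fin m, S * (C * ‖e m‖) := by
          refine Finset.sum_le_sum fun i _ => (real_inner_le_norm _ _).trans ?_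
          exact mul_le_mul (hdist i) (hbound i) (norm_nonneg _) hS0
      _ = m * (S * (C * ‖e m‖)) := by simp
  have hle : ‖e m‖ ≤ m * C * S := by
    rcases (norm_nonneg (e m)).eq_or_lt with h0 | hpos
    · rw [← h0]; positivity
    · exact le_of_mul_le_mul_right (by linarith) hpos
  have hCS : S ^ 2 ≤ m * ∑ i ∈ Finset.range m, ‖e i - e (i + 1)‖ ^ 2 := by
    simpa using sq_sum_le_card_mul_sum_sq (s := Finset.range m)
      (f := fun i => ‖e i - e (i + 1)‖)
  calc ‖e m‖ ^ 2 ≤ (m * C * S) ^ 2 := by gcongr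
    _ = (m * C) ^ 2 * S ^ 2 := by ring
    _ ≤ (m * C) ^ 2 * (m * ∑ i ∈ Finset.range m, ‖e i - e (i + 1)‖ ^ 2) := by gcongr
    _ = _ := by ring

/-- Geometric convergence of the multiplicative Schwarz iteration: if the closed subspaces
`V_1, …, V_m` sum to the whole Hilbert space `V`, then there is a contraction factor
`L ∈ [0,1)`, independent of the target `u`, the initial guess `u^0` and the iteration,
such that `‖u - u^{n,m}‖ ≤ L^n ‖u - u^0‖` for all `n ≥ 1`.  Here `useq n i` stands for
`u^{n,i}` (`n ≥ 1`, `0 ≤ i ≤ m`). -/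
theorem schwarz_geometric_convergence {V : Type*} [NormedAddCommGroup V]
    [InnerProductSpace ℝ V] [CompleteSpace V] {m : ℕ} (Vsub : Fin m → Submodule ℝ V)
    (hclosed : ∀ i, IsClosed ((Vsub i) : Set V))
    (hsum : ∀ v : V, ∃ f : Fin m → V, (∀ i, f i ∈ Vsub i) ∧ v = ∑ i, f i) :
    ∃ L : ℝ, 0 ≤ L ∧ L < 1 ∧
      ∀ (u u0 : V) (useq : ℕ → ℕ → V),
        useq 1 0 = u0 →
        (∀ n, 2 ≤ n → useq n 0 = useq (n - 1) m) →
        (∀ n, 1 ≤ n → ∀ i : Fin m, useq n (i + 1) - useq n i ∈ Vsub i) →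
        (∀ n, 1 ≤ n → ∀ i : Fin m, ∀ v ∈ Vsub i, ⟪u - useq n (i + 1), v⟫ = 0) →
        ∀ n, 1 ≤ n → ‖u - useq n m‖ ≤ L ^ n * ‖u - u0‖ := by
  obtain ⟨C, hC, hdecomp⟩ := exists_bounded_decomposition Vsub hclosed hsum
  set K : ℝ := (m * C) ^ 2 * m with hK
  have hK0 : 0 ≤ K := by positivity
  refine ⟨√(K / (1 + K)), Real.sqrt_nonneg _, ?_, ?_⟩
  · rw [Real.sqrt_lt' one_pos, one_pow, div_lt_one (by positivity)]
    linarith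
  intro u u0 useq hinit hnext hmem horth
  have hsweep (n : ℕ) (hn : 1 ≤ n) :
      ‖u - useq n m‖ ≤ √(K / (1 + K)) * ‖u - useq n 0‖ := by
    have h := norm_sq_sweep_le Vsub hC.le hdecomp (fun i => u - useq n i)
      (fun i => by simpa using hmem n hn i) (horth n hn)
    rw [← hK] at h
    refine abs_le_of_sq_le_sq' ?_ (by positivity) |>.2
    rw [mul_pow, Real.sq_sqrt (by positivity), div_mul_eq_mul_div, le_div_iff₀ (by positivity)]
    linarith
  intro n hn
  induction n, hn using Nat.le_induction with
  | base => simpa [hinit] using hsweep 1 le_rfl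
  | succ n hn ih =>
    have h := hsweep (n + 1) (by omega)
    rw [hnext (n + 1) (by omega), Nat.add_sub_cancel] at h
    calc _ ≤ _ := h
      _ ≤ √(K / (1 + K)) * (√(K / (1 + K)) ^ n * ‖u - u0‖) := by gcongr
      _ = _ := by ring
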